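/- For every l ≥ 1, if w ∈ H_{m_{l+1}} ∩ Σ_{i=1}^{l} B_{m_{i+1}}(F_i), then R_{l+1}(w) = 0. -/

import Mathlib

open scoped Classical BigOperators

noncomputable section

/-- The free associative unital `K`-algebra on six generators `x1 x2 x3 y1 y2 y3`,
realized as the monoid algebra of the free monoid on six letters. -/
abbrev FreeA (K : Type) [Field K] : Type := MonoidAlgebra K (FreeMonoid (Fin 6))

/-- The map sending the generators `x1 x2 x3` to `x` and `y1 y2 y3` to `y`. -/
def bf : Fin 6 → Fin 2 := fun i => if (i : ℕ) < 3 then 0 else 1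

/-- The monoid homomorphism `β` from monomials in six letters to monomials in two letters. -/
def bm : FreeMonoid (Fin 6) →* FreeMonoid (Fin 2) := FreeMonoid.map bf

/-- Degree (length) of a monomial. -/
def len {α : Type} (w : FreeMonoid α) : ℕ := (FreeMonoid.toList w).length

/-- The ordering `≺` on monomials in `x, y`: same degree and lexicographically smaller. -/
def prec (z z' : FreeMonoid (Fin 2)) : Prop :=
  len z = len z' ∧ List.Lex (· < ·) (FreeMonoid.toList z) (FreeMonoid.toList z')

/-- The finite set of monomials of degree `n` in six letters. -/
def wordsOf (n : ℕ) : Finset (FreeMonoid (Fin 6)) :=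
  (Finset.univ : Finset (Fin n → Fin 6)).image fun f => FreeMonoid.ofList (List.ofFn f)

/-- `wComp K z n` is `z(n₁,…,n₆)`: the sum of all monomials `v` (in six letters) with
`β v = z` and with exactly `nᵢ` occurrences of the `i`-th generator; it is `0` if no such
monomial exists (in particular if some `nᵢ` is negative). -/
def wComp (K : Type) [Field K] (z : FreeMonoid (Fin 2)) (n : Fin 6 → ℤ) : FreeA K :=
  ∑ v ∈ (wordsOf (len z)).filter
      (fun v => bm v = z ∧ ∀ e : Fin 6, ((FreeMonoid.toList v).count e : ℤ) = n e),
    MonoidAlgebra.single v 1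

/-- `H_i`: the `K`-span of the monomials of degree `i`. -/
def Hgr (K : Type) [Field K] (i : ℕ) : Submodule K (FreeA K) :=
  Submodule.span K {a | ∃ w : FreeMonoid (Fin 6), len w = i ∧ a = MonoidAlgebra.single w (1 : K)}

/-- `S(z)` for `z` a monomial in `x, y`: the span of the monomials `w` in six letters of the
same degree with `β w ≺ z`.  (For a monomial `z` in six letters, `S(z) = SP K (bm z)`.) -/
def SP (K : Type) [Field K] (z : FreeMonoid (Fin 2)) : Submodule K (FreeA K) :=
  Submodule.span K
    {a | ∃ w : FreeMonoid (Fin 6), len w = len z ∧ prec (bm w) z ∧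
      a = MonoidAlgebra.single w (1 : K)}

/-- `Q(z)`: the span of the monomials `w` of the same degree with `β w = z`. -/
def QP (K : Type) [Field K] (z : FreeMonoid (Fin 2)) : Submodule K (FreeA K) :=
  Submodule.span K
    {a | ∃ w : FreeMonoid (Fin 6), len w = len z ∧ bm w = z ∧
      a = MonoidAlgebra.single w (1 : K)}

end

noncomputable section

def Bid (K : Type) [Field K] (n : ℕ) (F : Set (FreeA K)) : Submodule K (FreeA K) :=
  Submodule.span K
    {x | ∃ (k : ℕ) (w : FreeMonoid (Fin 6)), len w = n * k ∧
      ∃ f ∈ F, ∃ b : FreeA K, x = MonoidAlgebra.single w 1 * f * b}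

end


noncomputable section

theorem len_mul {α : Type} (u v : FreeMonoid α) : len (u * v) = len u + len v :=
  List.length_append

theorem FreeMonoid.exists_mul_of_le_len {α : Type} (u : FreeMonoid α) {n : ℕ} (h : n ≤ len u) :
    ∃ p q : FreeMonoid α, u = p * q ∧ len p = n :=
  ⟨FreeMonoid.ofList (u.toList.take n), FreeMonoid.ofList (u.toList.drop n),
    (List.take_append_drop n u.toList).symm, List.length_take_of_le h⟩

/-- A word whose length is a multiple of `n` is a product of words of length `n`. -/
theorem FreeMonoid.exists_blocks {α : Type} (n j : ℕ) (u : FreeMonoid α) (h : len u = n * j) :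
    ∃ L : List (FreeMonoid α), L.length = j ∧ (∀ w ∈ L, len w = n) ∧ L.prod = u := by
  induction j generalizing u with
  | zero => exact ⟨[], rfl, by simp, (List.eq_nil_of_length_eq_zero h).symm⟩
  | succ j ih =>
    rw [Nat.mul_succ] at h
    obtain ⟨p, q, rfl, hp⟩ := u.exists_mul_of_le_len (n := n) (by lia)
    rw [len_mul] at h
    obtain ⟨L, hL, hlen, rfl⟩ := ih q (by lia)
    refine ⟨p :: L, by simp [hL], ?_, by simp⟩
    intro w hw
    rcases List.mem_cons.1 hw with rfl | hw
    exacts [hp, hlen w hw]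

variable {K : Type} [Field K]

theorem single_mem_Hgr {w : FreeMonoid (Fin 6)} {n : ℕ} (h : len w = n) :
    MonoidAlgebra.single w (1 : K) ∈ Hgr K n :=
  Submodule.subset_span ⟨w, h, rfl⟩

theorem linearMap_eqOn_Hgr {V : Type*} [AddCommGroup V] [Module K V] {n : ℕ}
    {φ ψ : FreeA K →ₗ[K] V}
    (h : ∀ w, len w = n → φ (MonoidAlgebra.single w 1) = ψ (MonoidAlgebra.single w 1))
    {a : FreeA K} (ha : a ∈ Hgr K n) : φ a = ψ a := by
  refine LinearMap.eqOn_span ?_ ha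
  rintro _ ⟨w, hw, rfl⟩
  exact h w hw

theorem mul_mem_Hgr {i j : ℕ} {a b : FreeA K} (ha : a ∈ Hgr K i) (hb : b ∈ Hgr K j) :
    a * b ∈ Hgr K (i + j) := by
  refine Submodule.mul_le.1 ((Submodule.span_mul_span K _ _).trans_le ?_) a ha b hb
  rw [Submodule.span_le]
  rintro _ ⟨_, ⟨u, rfl, rfl⟩, _, ⟨v, rfl, rfl⟩, rfl⟩
  simpa using single_mem_Hgr (K := K) (len_mul u v)

theorem exists_homogeneousComponent (K : Type) [Field K] (n : ℕ) :
    ∃ D : FreeA K →ₗ[K] FreeA K,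
      ∀ i, ∀ a ∈ Hgr K i, D a = if i = n then a else 0 := by
  let D : FreeA K →ₗ[K] FreeA K :=
    (Finsupp.linearCombination K fun w : FreeMonoid (Fin 6) =>
      if len w = n then MonoidAlgebra.single w (1 : K) else 0) ∘ₗ
      (MonoidAlgebra.coeffLinearEquiv K).toLinearMap
  have hD (w) : D (MonoidAlgebra.single w 1) =
      if len w = n then MonoidAlgebra.single w (1 : K) else 0 := by
    simp [D]
  refine ⟨D, fun i a ha => ?_⟩
  split_ifs with h
  · refine linearMap_eqOn_Hgr (ψ := LinearMap.id) (fun w hw => ?_) ha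
    simp [hD, hw, h]
  · refine linearMap_eqOn_Hgr (ψ := 0) (fun w hw => ?_) ha
    simp [hD, hw, h]

/-- If `S` acts blockwise through `R`, twisted by `c` on the first block, then on a fixed block it
is a two-sided multiple of `c ∘ R` (first block) or of `R` (later blocks). -/
theorem exists_factor_of_blockwise {n N : ℕ} (hn : 0 < n) {R c S : FreeA K →ₗ[K] FreeA K}
    (hrec : ∀ L : List (FreeMonoid (Fin 6)), L.length = N / n → (∀ w ∈ L, len w = n) →
      S (MonoidAlgebra.single L.prod 1) = c (R (MonoidAlgebra.single L.headI 1)) *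
        (L.tail.map fun w => R (MonoidAlgebra.single w 1)).prod)
    {j k : ℕ} {p q : FreeMonoid (Fin 6)} (hp : len p = n * j) (hq : len q = n * k)
    (hN : n * j + n + n * k = N) :
    ∃ P Q : FreeA K, ∀ x ∈ Hgr K n,
      S (MonoidAlgebra.single p 1 * x * MonoidAlgebra.single q 1) =
        P * (if j = 0 then c (R x) else R x) * Q := by
  have hdiv : N / n = j + 1 + k := by
    rw [← hN, show n * j + n + n * k = n * (j + 1 + k) by ring, Nat.mul_div_cancel_left _ hn]
  obtain ⟨A, hA, hAlen, rfl⟩ := FreeMonoid.exists_blocks n j p hp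
  obtain ⟨B, hB, hBlen, rfl⟩ := FreeMonoid.exists_blocks n k q hq
  have key (w : FreeMonoid (Fin 6)) (hw : len w = n) :=
    hrec (A ++ w :: B) (by simp [hA, hB, hdiv]; ring) (by
      intro v hv
      rcases List.mem_append.1 hv with hv | hv
      · exact hAlen v hv
      · rcases List.mem_cons.1 hv with rfl | hv
        exacts [hw, hBlen v hv])
  cases A with
  | nil =>
    have hj : j = 0 := by simpa using hA.symm
    refine ⟨1, (B.map fun w => R (MonoidAlgebra.single w 1)).prod, fun x hx => ?_⟩
    have h := linearMap_eqOn_Hgr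
      (φ := S ∘ₗ LinearMap.mulRight K (MonoidAlgebra.single B.prod 1))
      (ψ := LinearMap.mulRight K (B.map fun w => R (MonoidAlgebra.single w 1)).prod ∘ₗ c ∘ₗ R)
      (fun w hw => by simpa using key w hw) hx
    simpa [hj, ← MonoidAlgebra.one_def] using h
  | cons a A =>
    have hj : j ≠ 0 := by
      rintro rfl
      simp at hA
    refine ⟨c (R (MonoidAlgebra.single a 1)) *
        (A.map fun w => R (MonoidAlgebra.single w 1)).prod,
      (B.map fun w => R (MonoidAlgebra.single w 1)).prod, fun x hx => ?_⟩
    have h := linearMap_eqOn_Hgr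
      (φ := S ∘ₗ LinearMap.mulRight K (MonoidAlgebra.single B.prod 1) ∘ₗ
        LinearMap.mulLeft K (MonoidAlgebra.single (a :: A).prod 1))
      (ψ := LinearMap.mulRight K (B.map fun w => R (MonoidAlgebra.single w 1)).prod ∘ₗ
        LinearMap.mulLeft K (c (R (MonoidAlgebra.single a 1)) *
          (A.map fun w => R (MonoidAlgebra.single w 1)).prod) ∘ₗ R)
      (fun w hw => by simpa [mul_assoc] using key w hw) hx
    simpa [hj, mul_assoc] using h

/-- The map `R (l + 1)` kills the homogeneous generators of `Bid K (m (i + 1)) (F i)`. -/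
theorem map_generator_eq_zero {m : ℕ → ℕ} (hpos : ∀ i, 0 < m i) (hlt : ∀ i, m i < m (i + 1))
    (hdvd : ∀ i, m i ∣ m (i + 1))
    {F : ℕ → Set (FreeA K)} (hF : ∀ i, F i ⊆ Hgr K (m i))
    {R c : ℕ → FreeA K →ₗ[K] FreeA K}
    (hc : ∀ i, ∀ f ∈ F i, c i (R i f) = 0)
    (hrec : ∀ (i : ℕ) (L : List (FreeMonoid (Fin 6))),
      L.length = m (i + 1) / m i → (∀ w ∈ L, len w = m i) →
      R (i + 1) (MonoidAlgebra.single L.prod 1) =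
        c i (R i (MonoidAlgebra.single L.headI 1)) *
          (L.tail.map fun w => R i (MonoidAlgebra.single w 1)).prod)
    {l i k : ℕ} (hi : i ≤ l) {u v : FreeMonoid (Fin 6)} {f : FreeA K} (hf : f ∈ F i)
    (hu : len u = m (i + 1) * k) (hlen : len u + m i + len v = m (l + 1)) :
    R (l + 1) (MonoidAlgebra.single u 1 * f * MonoidAlgebra.single v 1) = 0 := by
  induction l using Nat.strong_induction_on generalizing i k u v f with
  | h l ih =>
    rcases hi.eq_or_lt with rfl | hil
    · have hk : k = 0 := by
        by_contra hk
        have := Nat.le_mul_of_pos_right (m (i + 1)) (Nat.pos_of_ne_zero hk)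
        have := hpos i
        lia
      subst hk
      obtain ⟨t, ht⟩ : m i ∣ len v :=
        (Nat.dvd_add_right (dvd_refl (m i))).1 <| by
          rw [show m i + len v = m (i + 1) by lia]
          exact hdvd i
      obtain ⟨P, Q, h⟩ := exists_factor_of_blockwise (hpos i) (hrec i) (j := 0) (by simpa using hu) ht
        (by rw [← hlen, hu, ht]; simp)
      simp [h f (hF i hf), hc i f hf]
    · obtain ⟨l, rfl⟩ := Nat.exists_eq_add_of_lt (Nat.zero_lt_of_lt hil)
      simp only [Nat.zero_add] at *
      obtain ⟨s, hs⟩ : m (i + 1) ∣ m (l + 1) := Nat.le_induction (dvd_refl _)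
        (fun n _ h => h.trans (hdvd n)) (l + 1) hil
      obtain ⟨t, ht⟩ := hdvd (l + 1)
      have hM := hpos (l + 1)
      have hmi := hlt i
      set M := m (l + 1)
      set j := k / s
      have hs0 : 0 < s := Nat.pos_of_ne_zero (by rintro rfl; simp at hs; lia)
      have hksj : s * j + k % s = k := Nat.div_add_mod k s
      have hkmod : k % s + 1 ≤ s := Nat.mod_lt k hs0
      have hu' : len u = M * j + m (i + 1) * (k % s) := by
        rw [hu, hs, mul_assoc, ← Nat.mul_add, hksj]
      have hfit : m (i + 1) * (k % s) + m (i + 1) ≤ M := by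
        rw [hs]; exact Nat.mul_le_mul_left (m (i + 1)) hkmod
      have hmipos := hpos i
      obtain ⟨r, hr⟩ : ∃ r, t = j + 1 + r := by
        refine Nat.exists_eq_add_of_le (Nat.lt_of_mul_lt_mul_left (a := M) ?_)
        rw [← ht]
        lia
      have hr' : M * t = M * j + M + M * r := by rw [hr]; ring
      obtain ⟨p, u, rfl, hp⟩ := u.exists_mul_of_le_len (n := M * j) (by lia)
      obtain ⟨v, q, rfl, hv⟩ := v.exists_mul_of_le_len
        (n := M - (m (i + 1) * (k % s) + m i)) (by lia)
      simp only [len_mul] at hu' hlen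
      obtain ⟨P, Q, h⟩ := exists_factor_of_blockwise hM (hrec (l + 1)) (p := p) (q := q) hp
        (k := r) (by lia) (hr'.symm.trans ht.symm)
      have hx : MonoidAlgebra.single u 1 * f * MonoidAlgebra.single v 1 ∈ Hgr K M := by
        have := mul_mem_Hgr (mul_mem_Hgr (single_mem_Hgr (K := K) (w := u) rfl) (hF i hf))
          (single_mem_Hgr (K := K) (w := v) rfl)
        rwa [show len u + m i + len v = M by lia] at this
      have h0 := ih l (Nat.lt_succ_self l) (Nat.le_of_lt_succ hil) hf (u := u) (v := v)
        (k := k % s) (by lia) (by lia)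
      have h1 := h _ hx
      rw [h0] at h1
      rw [show MonoidAlgebra.single (p * u) (1 : K) = MonoidAlgebra.single p 1 *
          MonoidAlgebra.single u 1 by simp, show MonoidAlgebra.single (v * q) (1 : K) =
          MonoidAlgebra.single v 1 * MonoidAlgebra.single q 1 by simp]
      simpa only [mul_assoc, map_zero, ite_self, mul_zero, zero_mul] using h1

end

theorem stmt9 (K : Type) [Field K] (m : ℕ → ℕ)
    (hmono : StrictMono m) (hm1 : 10 ^ 8 < m 0)
    (hdvd : ∀ i, 40 * m i ∣ m (i + 1)) (hgrow : ∀ i, 2 ^ (i + 102) * m i < m (i + 1))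
    (F : ℕ → Finset (FreeA K)) (hF : ∀ i, (F i : Set (FreeA K)) ⊆ (Hgr K (m i) : Set (FreeA K)))
    (R c : ℕ → (FreeA K →ₗ[K] FreeA K))
    (hR0 : ∀ a ∈ Hgr K (m 0), R 0 a = a)
    (hRH : ∀ i, ∀ a ∈ Hgr K (m i), R i a ∈ Hgr K (m i))
    (hcH : ∀ i, ∀ a ∈ Hgr K (m i), c i a ∈ Hgr K (m i))
    (hcker : ∀ i, ∀ a ∈ Hgr K (m i),
      (c i a = 0 ↔ a ∈ Submodule.span K (⇑(R i) '' (F i : Set (FreeA K)))))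
    (hrec : ∀ (i : ℕ) (l : List (FreeMonoid (Fin 6))),
      l.length = m (i + 1) / m i → (∀ w ∈ l, len w = m i) →
      R (i + 1) (MonoidAlgebra.single l.prod 1) =
        c i (R i (MonoidAlgebra.single l.headI 1)) *
          (l.tail.map fun w => R i (MonoidAlgebra.single w 1)).prod) :
    ∀ l : ℕ, ∀ w ∈ Hgr K (m (l + 1)) ⊓
        ⨆ i ∈ Finset.range (l + 1), Bid K (m (i + 1)) (F i : Set (FreeA K)),
      R (l + 1) w = 0 := by
  intro l w hw
  obtain ⟨hwH, hw⟩ := Submodule.mem_inf.1 hw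
  obtain ⟨D, hD⟩ := exists_homogeneousComponent K (m (l + 1))
  suffices h : ⨆ i ∈ Finset.range (l + 1), Bid K (m (i + 1)) (F i : Set (FreeA K)) ≤
      LinearMap.ker (R (l + 1) ∘ₗ D) by
    simpa [hD _ w hwH] using h hw
  refine iSup₂_le fun i hi => Submodule.span_le.2 ?_
  rintro _ ⟨k, u, hu, f, hf, b, rfl⟩
  suffices h : (R (l + 1) ∘ₗ D) ∘ₗ LinearMap.mulLeft K (MonoidAlgebra.single u 1 * f) = 0 from
    LinearMap.congr_fun h b
  refine MonoidAlgebra.lhom_ext' fun v => LinearMap.ext_ring ?_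
  have hfH := mul_mem_Hgr (mul_mem_Hgr (single_mem_Hgr (K := K) (w := u) rfl) (hF i hf))
    (single_mem_Hgr (K := K) (w := v) rfl)
  have hpos (i) : 0 < m i := by have := hmono.monotone (Nat.zero_le i); lia
  suffices h : R (l + 1) (D (MonoidAlgebra.single u 1 * f * MonoidAlgebra.single v 1)) = 0 by
    simpa [mul_assoc] using h
  rw [hD _ _ hfH]
  split_ifs with hlen
  · refine map_generator_eq_zero (F := fun i => (F i : Set (FreeA K))) hpos
      (fun i => hmono i.lt_succ_self) (fun i => (Dvd.intro_left 40 rfl).trans (hdvd i)) hF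
      (fun i f hf => ?_) hrec (Nat.le_of_lt_succ (Finset.mem_range.1 hi)) hf hu hlen
    exact (hcker i _ (hRH i f (hF i hf))).2 (Submodule.subset_span ⟨f, hf, rfl⟩)
  · exact map_zero _
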